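/- arXiv:1405.4202 — 7 statements merged into one kernel-verified Lean document; each statement's English description precedes it below -/
import Mathlib

section
/- Let f : ℝ^n → ℝ be locally Lipschitz and upper-C¹ at a point δ̄ ∈ ℝ^n. Suppose δ^k → δ̄ and η^k → δ̄ are sequences in ℝ^n, and g_k ∈ ∂f(δ^k) are arbitrary Clarke subgradients. Then there exists a sequence ε_k → 0 of nonnegative reals such that f(η^k) ≤ f(δ^k) + ⟨g_k, η^k − δ^k⟩ + ε_k ‖η^k − δ^k‖ for all k. -/
open scoped RealInnerProductSpace

noncomputable section

structure LowerC1Witness (n : ℕ) (f : EuclideanSpace ℝ (Fin n) → ℝ)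
    (x₀ : EuclideanSpace ℝ (Fin n)) where
  K : Type
  [tK : TopologicalSpace K]
  [cK : CompactSpace K]
  [nK : Nonempty K]
  U : Set (EuclideanSpace ℝ (Fin n))
  openU : IsOpen U
  memU : x₀ ∈ U
  F : EuclideanSpace ℝ (Fin n) → K → ℝ
  DF : EuclideanSpace ℝ (Fin n) → K → (EuclideanSpace ℝ (Fin n) →L[ℝ] ℝ)
  contF : ContinuousOn (fun p : EuclideanSpace ℝ (Fin n) × K => F p.1 p.2) (U ×ˢ Set.univ)
  hasDF : ∀ x ∈ U, ∀ y : K, HasFDerivAt (fun x' => F x' y) (DF x y) x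
  contDF : ContinuousOn (fun p : EuclideanSpace ℝ (Fin n) × K => DF p.1 p.2) (U ×ˢ Set.univ)
  isMax : ∀ x ∈ U, IsGreatest (Set.range fun y : K => F x y) (f x)

def LowerC1At (n : ℕ) (f : EuclideanSpace ℝ (Fin n) → ℝ)
    (x₀ : EuclideanSpace ℝ (Fin n)) : Prop :=
  Nonempty (LowerC1Witness n f x₀)

def UpperC1At (n : ℕ) (f : EuclideanSpace ℝ (Fin n) → ℝ)
    (x₀ : EuclideanSpace ℝ (Fin n)) : Prop :=
  LowerC1At n (fun x => -(f x)) x₀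

/-- The Clarke directional derivative. -/
def clarkeDeriv (n : ℕ) (f : EuclideanSpace ℝ (Fin n) → ℝ)
    (x d : EuclideanSpace ℝ (Fin n)) : ℝ :=
  Filter.limsup (fun p : EuclideanSpace ℝ (Fin n) × ℝ => (f (p.1 + p.2 • d) - f p.1) / p.2)
    ((nhds x) ×ˢ (nhdsWithin 0 (Set.Ioi (0 : ℝ))))

/-- The Clarke subdifferential. -/
def clarkeSubdiff (n : ℕ) (f : EuclideanSpace ℝ (Fin n) → ℝ)
    (x : EuclideanSpace ℝ (Fin n)) : Set (EuclideanSpace ℝ (Fin n)) :=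
  {g | ∀ d, ⟪g, d⟫ ≤ clarkeDeriv n f x d}

namespace LowerC1Witness

variable {n : ℕ} {h : EuclideanSpace ℝ (Fin n) → ℝ} {x₀ : EuclideanSpace ℝ (Fin n)}

/-- The representing functions have a first-order expansion with base derivative at `x₀` that is
uniform in the parameter. -/
theorem exists_uniform_expansion (w : LowerC1Witness n h x₀) {ε : ℝ} (hε : 0 < ε) :
    ∃ r > 0, Metric.ball x₀ r ⊆ w.U ∧
      ∀ y : w.K, ∀ a ∈ Metric.ball x₀ r, ∀ b ∈ Metric.ball x₀ r,
        |w.F a y - w.F b y - w.DF x₀ y (a - b)| ≤ ε * ‖a - b‖ := by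
  let := w.tK
  have := w.cK
  have hclose : ∀ᶠ x in nhds x₀, ∀ y ∈ (Set.univ : Set w.K),
      ‖w.DF x y - w.DF x₀ y‖ < ε := by
    refine isCompact_univ.eventually_forall_of_forall_eventually fun y _ => ?_
    have hDF : ContinuousAt
        (fun p : EuclideanSpace ℝ (Fin n) × w.K => w.DF p.1 p.2) (x₀, y) :=
      w.contDF.continuousAt
        ((w.openU.prod isOpen_univ).mem_nhds ⟨w.memU, Set.mem_univ y⟩)
    have hDF₀ : ContinuousAt
        (fun p : EuclideanSpace ℝ (Fin n) × w.K => w.DF x₀ p.2) (x₀, y) :=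
      ContinuousAt.comp (f := fun p : EuclideanSpace ℝ (Fin n) × w.K => (x₀, p.2))
        (x := (x₀, y)) hDF (by fun_prop)
    have hnorm := (hDF.sub hDF₀).norm
    exact hnorm.eventually_lt continuousAt_const (by simpa using hε)
  obtain ⟨r, hr, hball⟩ := Metric.eventually_nhds_iff_ball.1
    (hclose.and (w.openU.mem_nhds w.memU))
  refine ⟨r, hr, fun x hx => (hball x hx).2, fun y a ha b hb => ?_⟩
  have hmean := (convex_ball x₀ r).norm_image_sub_le_of_norm_hasFDerivWithin_le'
    (f := fun x => w.F x y) (f' := fun x => w.DF x y) (φ := w.DF x₀ y) (C := ε)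
    (fun x hx => (w.hasDF x (hball x hx).2 y).hasFDerivWithinAt)
    (fun x hx => ((hball x hx).1 y (Set.mem_univ y)).le) hb ha
  exact hmean

theorem exists_norm_derivative_le (w : LowerC1Witness n h x₀) :
    ∃ M : ℝ, ∀ y : w.K, ‖w.DF x₀ y‖ ≤ M := by
  let := w.tK
  have := w.cK
  have hcont : ContinuousOn (fun y : w.K => w.DF x₀ y) Set.univ :=
    w.contDF.comp (f := fun y : w.K => (x₀, y)) (by fun_prop)
      fun y _ => ⟨w.memU, Set.mem_univ y⟩
  obtain ⟨M, hM⟩ := isCompact_univ.exists_bound_of_continuousOn hcont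
  exact ⟨M, fun y => hM y (Set.mem_univ y)⟩

end LowerC1Witness

theorem tendsto_add_smul_nhds {n : ℕ} (x d : EuclideanSpace ℝ (Fin n)) :
    Filter.Tendsto (fun p : EuclideanSpace ℝ (Fin n) × ℝ => p.1 + p.2 • d)
      (nhds x ×ˢ nhdsWithin 0 (Set.Ioi (0 : ℝ))) (nhds x) := by
  have hsnd := (Filter.tendsto_snd (f := nhds x)
    (g := nhdsWithin 0 (Set.Ioi (0 : ℝ)))).mono_right nhdsWithin_le_nhds
  simpa using Filter.tendsto_fst.add (hsnd.smul_const d)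

/-- The difference quotients of a locally Lipschitz function are bounded. -/
theorem LocallyLipschitz.eventually_abs_differenceQuotient_le {n : ℕ}
    {f : EuclideanSpace ℝ (Fin n) → ℝ} (hf : LocallyLipschitz f)
    (x d : EuclideanSpace ℝ (Fin n)) :
    ∃ C : ℝ, ∀ᶠ p : EuclideanSpace ℝ (Fin n) × ℝ in
      nhds x ×ˢ nhdsWithin 0 (Set.Ioi (0 : ℝ)), |(f (p.1 + p.2 • d) - f p.1) / p.2| ≤ C := by
  obtain ⟨L, s, hs, hL⟩ := hf x
  refine ⟨L * ‖d‖, ?_⟩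
  have hfst : Filter.Tendsto (Prod.fst : EuclideanSpace ℝ (Fin n) × ℝ → _)
      (nhds x ×ˢ nhdsWithin 0 (Set.Ioi (0 : ℝ))) (nhds x) := Filter.tendsto_fst
  have hsnd : Filter.Tendsto (Prod.snd : EuclideanSpace ℝ (Fin n) × ℝ → _)
      (nhds x ×ˢ nhdsWithin 0 (Set.Ioi (0 : ℝ))) (nhdsWithin 0 (Set.Ioi 0)) :=
    Filter.tendsto_snd
  have hmove := tendsto_add_smul_nhds x d
  filter_upwards [hfst hs, hmove hs, hsnd self_mem_nhdsWithin] with p hp hq ht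
  have ht : 0 < p.2 := ht
  rw [abs_div, abs_of_pos ht, div_le_iff₀ ht]
  have := hL.dist_le_mul _ hq _ hp
  rw [Real.dist_eq, dist_eq_norm, add_sub_cancel_left, norm_smul, Real.norm_of_nonneg ht.le] at this
  linarith

/-- Near a point where `f` is upper-C¹, the Clarke derivative of `f` at `x` in the direction `x - z`
is at most `f x - f z`, up to an arbitrarily small multiple of `‖x - z‖`. -/
theorem UpperC1At.exists_ball_clarkeDeriv_le {n : ℕ} {f : EuclideanSpace ℝ (Fin n) → ℝ}
    {x₀ : EuclideanSpace ℝ (Fin n)} (hf : LocallyLipschitz f) (hupper : UpperC1At n f x₀)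
    {ε : ℝ} (hε : 0 < ε) :
    ∃ r > 0, ∀ x ∈ Metric.ball x₀ r, ∀ z ∈ Metric.ball x₀ r,
      clarkeDeriv n f x (x - z) ≤ f x - f z + ε * ‖x - z‖ := by
  obtain ⟨w⟩ := hupper
  obtain ⟨r, hr, hU, hexp⟩ := w.exists_uniform_expansion (half_pos hε)
  obtain ⟨M, hM⟩ := w.exists_norm_derivative_le
  refine ⟨r, hr, fun x hx z hz => le_of_forall_pos_le_add fun c hc => ?_⟩
  obtain ⟨C, hC⟩ := hf.eventually_abs_differenceQuotient_le x (x - z)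
  refine Filter.limsup_le_of_le
    (Filter.IsBoundedUnder.isCoboundedUnder_le
      (Filter.isBoundedUnder_of_eventually_ge (a := -C)
        (hC.mono fun p hp => (abs_le.1 hp).1))) ?_
  have hfst : Filter.Tendsto (Prod.fst : EuclideanSpace ℝ (Fin n) × ℝ → _)
      (nhds x ×ˢ nhdsWithin 0 (Set.Ioi (0 : ℝ))) (nhds x) := Filter.tendsto_fst
  have hsnd : Filter.Tendsto (Prod.snd : EuclideanSpace ℝ (Fin n) × ℝ → _)
      (nhds x ×ˢ nhdsWithin 0 (Set.Ioi (0 : ℝ))) (nhdsWithin 0 (Set.Ioi 0)) :=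
    Filter.tendsto_snd
  have hmove := tendsto_add_smul_nhds x (x - z)
  have hnhds : Metric.ball x₀ r ∈ nhds x := Metric.isOpen_ball.mem_nhds hx
  have herr : ∀ᶠ u in nhds x,
      f u - f z + M * ‖x - u‖ + ε / 2 * ‖z - u‖ + ε / 2 * ‖x - z‖
        < f x - f z + ε * ‖x - z‖ + c := by
    have hfc := hf.continuous
    refine ContinuousAt.eventually_lt (by fun_prop) continuousAt_const ?_
    rw [norm_sub_rev z x]
    simp only [sub_self, norm_zero]
    linarith
  filter_upwards [hfst hnhds, hmove hnhds, hsnd self_mem_nhdsWithin, hfst herr]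
    with p hp hq ht herrp
  have ht : 0 < p.2 := ht
  have herrp : f p.1 - f z + M * ‖x - p.1‖ + ε / 2 * ‖z - p.1‖ + ε / 2 * ‖x - z‖
        < f x - f z + ε * ‖x - z‖ + c := herrp
  obtain ⟨y, hy⟩ := (w.isMax p.1 (hU hp)).1
  have hy : w.F p.1 y = -f p.1 := hy
  have hyq : w.F (p.1 + p.2 • (x - z)) y ≤ -f (p.1 + p.2 • (x - z)) :=
    (w.isMax _ (hU hq)).2 ⟨y, rfl⟩
  have hyz : w.F z y ≤ -f z := (w.isMax z (hU hz)).2 ⟨y, rfl⟩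
  have hstep := (abs_le.1 (hexp y _ hq _ hp)).1
  rw [add_sub_cancel_left, map_smul, norm_smul, Real.norm_of_nonneg ht.le, smul_eq_mul] at hstep
  have hquot : (f (p.1 + p.2 • (x - z)) - f p.1) / p.2
      ≤ -w.DF x₀ y (x - z) + ε / 2 * ‖x - z‖ := by
    rw [div_le_iff₀ ht]
    linarith
  have hfar := (abs_le.1 (hexp y _ hz _ hp)).1
  have hsplit : w.DF x₀ y (z - p.1) = w.DF x₀ y (x - p.1) - w.DF x₀ y (x - z) := by
    rw [← map_sub, sub_sub_sub_cancel_left]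
  have hsmall : |w.DF x₀ y (x - p.1)| ≤ M * ‖x - p.1‖ :=
    (w.DF x₀ y).le_of_opNorm_le (hM y) _
  linarith [(abs_le.1 hsmall).1]

/-- for `f` locally Lipschitz and upper-C¹ at `δ̄`, sequences `δᵏ → δ̄`,
`ηᵏ → δ̄` and arbitrary Clarke subgradients `gₖ ∈ ∂f(δᵏ)`, there are `εₖ → 0`, `εₖ ≥ 0`,
with `f(ηᵏ) ≤ f(δᵏ) + ⟨gₖ, ηᵏ − δᵏ⟩ + εₖ ‖ηᵏ − δᵏ‖`. -/
theorem upperC1At_subgradient_estimate (n : ℕ) (f : EuclideanSpace ℝ (Fin n) → ℝ)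
    (δbar : EuclideanSpace ℝ (Fin n)) (hlip : LocallyLipschitz f)
    (hupper : UpperC1At n f δbar)
    (δ η : ℕ → EuclideanSpace ℝ (Fin n))
    (hδ : Filter.Tendsto δ Filter.atTop (nhds δbar))
    (hη : Filter.Tendsto η Filter.atTop (nhds δbar))
    (g : ℕ → EuclideanSpace ℝ (Fin n))
    (hg : ∀ k, g k ∈ clarkeSubdiff n f (δ k)) :
    ∃ ε : ℕ → ℝ, (∀ k, 0 ≤ ε k) ∧ Filter.Tendsto ε Filter.atTop (nhds 0) ∧
      ∀ k, f (η k) ≤ f (δ k) + ⟪g k, η k - δ k⟫ + ε k * ‖η k - δ k‖ := by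
  refine ⟨fun k => max 0 ((f (η k) - f (δ k) - ⟪g k, η k - δ k⟫) / ‖η k - δ k‖),
    fun k => le_max_left _ _, ?_, fun k => ?_⟩
  · refine Metric.tendsto_nhds.2 fun e he => ?_
    obtain ⟨r, hr, hball⟩ := hupper.exists_ball_clarkeDeriv_le hlip (half_pos he)
    filter_upwards [hδ (Metric.ball_mem_nhds _ hr), hη (Metric.ball_mem_nhds _ hr)] with k hkδ hkη
    rw [Real.dist_0_eq_abs, abs_of_nonneg (le_max_left _ _)]
    refine (max_le (half_pos he).le (div_le_of_le_mul₀ (norm_nonneg _) (half_pos he).le ?_)).trans_lt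
      (half_lt_self he)
    have hsub := (hg k (δ k - η k)).trans (hball _ hkδ _ hkη)
    rw [← neg_sub (η k) (δ k), inner_neg_right, norm_neg] at hsub
    linarith
  · rcases eq_or_ne (η k) (δ k) with heq | hne
    · simp [heq]
    · have hpos : 0 < ‖η k - δ k‖ := norm_pos_iff.2 (sub_ne_zero.2 hne)
      have hmax := (div_le_iff₀ hpos).1
        (le_max_right 0 ((f (η k) - f (δ k) - ⟪g k, η k - δ k⟫) / ‖η k - δ k‖))
      linarith

end
end

section
/- Let A : ℝ^m → ℝ^{n×n} be a continuously differentiable matrix-valued map and let δ₀ ∈ ℝ^m. Suppose every active eigenvalue of A(δ₀), i.e. every root λ ∈ ℂ of the characteristic polynomial of A(δ₀) with Re λ = α(A(δ₀)), is a simple root of that characteristic polynomial. Then the function a_−(δ) = −α(A(δ)) is upper-C¹ at δ₀ (equivalently, δ ↦ α(A(δ)) is lower-C¹ at δ₀). -/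
noncomputable section

/-- The spectral abscissa of a real square matrix: the largest real part of a root in `ℂ`
of its characteristic polynomial. -/
def specAbscissa {n : ℕ} (M : Matrix (Fin n) (Fin n) ℝ) : ℝ :=
  sSup (Complex.re '' {z : ℂ | (M.charpoly.map (algebraMap ℝ ℂ)).IsRoot z})

open Filter Topology Polynomial

/-- A maximum of finitely many functions that are `C¹` at a point is lower-`C¹` there. -/
theorem LowerC1At.of_isGreatest_range {m : ℕ} {ι : Type} [Finite ι] [Nonempty ι]
    {f : EuclideanSpace ℝ (Fin m) → ℝ} {x₀ : EuclideanSpace ℝ (Fin m)}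
    (g : ι → EuclideanSpace ℝ (Fin m) → ℝ) (hg : ∀ i, ContDiffAt ℝ 1 (g i) x₀)
    (hf : ∀ᶠ x in 𝓝 x₀, IsGreatest (Set.range fun i => g i x) (f x)) :
    LowerC1At m f x₀ := by
  have hev : ∀ᶠ x in 𝓝 x₀, (∀ i, ContDiffAt ℝ 1 (g i) x) ∧
      IsGreatest (Set.range fun i => g i x) (f x) :=
    (eventually_all.2 fun i => (hg i).eventually (by simp)).and hf
  obtain ⟨U, hU, hUo, hxU⟩ := eventually_nhds_iff.1 hev
  let _ : TopologicalSpace ι := ⊥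
  have : DiscreteTopology ι := ⟨rfl⟩
  have hUg : ∀ i, ContDiffOn ℝ 1 (g i) U := fun i x hx => ((hU x hx).1 i).contDiffWithinAt
  exact ⟨{
    K := ι
    U := U
    openU := hUo
    memU := hxU
    F := fun x i => g i x
    DF := fun x i => fderiv ℝ (g i) x
    contF := continuousOn_prod_of_discrete_right.2 fun i => by
      simpa using (hUg i).continuousOn
    hasDF := fun x hx i => (((hU x hx).1 i).differentiableAt (by simp)).hasFDerivAt
    contDF := continuousOn_prod_of_discrete_right.2 fun i => by
      simpa using (hUg i).continuousOn_fderiv_of_isOpen hUo le_rfl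
    isMax := fun x hx => (hU x hx).2 }⟩

/-- Implicit function theorem for a complex unknown whose partial derivative is a nonzero
complex number. -/
theorem ContDiffAt.exists_implicit_complex {E : Type*} [NormedAddCommGroup E] [NormedSpace ℝ E]
    [CompleteSpace E] {f : E × ℂ → ℂ} {x₀ : E} {z₀ c : ℂ} (hf : ContDiffAt ℝ 1 f (x₀, z₀))
    (h0 : f (x₀, z₀) = 0) (hd : HasDerivAt (fun z => f (x₀, z)) c z₀) (hc : c ≠ 0) :
    ∃ φ : E → ℂ, ContDiffAt ℝ 1 φ x₀ ∧ φ x₀ = z₀ ∧ (∀ᶠ x in 𝓝 x₀, f (x, φ x) = 0) ∧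
      ∀ᶠ v in 𝓝 (x₀, z₀), f v = 0 → φ v.1 = v.2 := by
  have hinv : (fderiv ℝ f (x₀, z₀) ∘L .inr ℝ E ℂ).IsInvertible := by
    have h1 : HasFDerivAt (fun z => f (x₀, z)) (fderiv ℝ f (x₀, z₀) ∘L .inr ℝ E ℂ) z₀ :=
      (hf.differentiableAt (by simp)).hasFDerivAt.comp z₀ (hasFDerivAt_prodMk_right x₀ z₀)
    rw [h1.unique (hd.hasFDerivAt.restrictScalars ℝ)]
    refine ⟨(ContinuousLinearEquiv.unitsEquivAut ℂ (Units.mk0 c hc)).restrictScalars ℝ, ?_⟩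
    ext z
    simp
  refine ⟨hf.implicitFunction (by simp) hinv, hf.contDiffAt_implicitFunction (by simp) hinv,
    hf.implicitFunction_apply_self (by simp) hinv, ?_, ?_⟩
  · simpa only [h0] using hf.eventually_apply_implicitFunction (by simp) hinv
  · filter_upwards [hf.eventually_apply_eq_iff_implicitFunction (by simp) hinv] with v hv h
    exact hv.1 (h.trans h0.symm)

theorem Polynomial.eval_derivative_ne_zero_of_rootMultiplicity_eq_one {p : ℂ[X]} {z : ℂ}
    (h : p.rootMultiplicity z = 1) : (derivative p).eval z ≠ 0 := by
  intro hd
  have hp : p ≠ 0 := by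
    rintro rfl
    simp at h
  have hz : p.IsRoot z := (rootMultiplicity_pos hp).1 (by omega)
  have := (one_lt_rootMultiplicity_iff_isRoot hp).2 ⟨hz, hd⟩
  omega

theorem contDiff_eval_charpoly {E : Type*} [NormedAddCommGroup E] [NormedSpace ℝ E] {n : ℕ}
    {A : E → Matrix (Fin n) (Fin n) ℝ} (hA : ∀ i j, ContDiff ℝ 1 fun δ => A δ i j) :
    ContDiff ℝ 1 fun p : E × ℂ => ((A p.1).charpoly.map (algebraMap ℝ ℂ)).eval p.2 := by
  simp_rw [← Matrix.charpoly_map, Matrix.eval_charpoly, Matrix.det_apply]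
  refine ContDiff.sum fun σ _ => ContDiff.const_smul _ (contDiff_prod fun i _ => ?_)
  have h : ContDiff ℝ 1 fun p : E × ℂ => ((A p.1 (σ i) i : ℝ) : ℂ) :=
    Complex.ofRealCLM.contDiff.comp ((hA _ _).comp contDiff_fst)
  by_cases hi : σ i = i
  · simpa [Matrix.scalar_apply, hi] using! contDiff_snd.sub (by simpa [hi] using h)
  · simpa [Matrix.scalar_apply, hi] using! h.neg

theorem finite_charpoly_roots {n : ℕ} (M : Matrix (Fin n) (Fin n) ℝ) :
    {z : ℂ | (M.charpoly.map (algebraMap ℝ ℂ)).IsRoot z}.Finite :=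
  finite_setOfPred_isRoot (M.charpoly_monic.map _).ne_zero

theorem isGreatest_specAbscissa {n : ℕ} (hn : n ≠ 0) (M : Matrix (Fin n) (Fin n) ℝ) :
    IsGreatest (Complex.re '' {z : ℂ | (M.charpoly.map (algebraMap ℝ ℂ)).IsRoot z})
      (specAbscissa M) := by
  have hfin := (finite_charpoly_roots M).image Complex.re
  refine ⟨Set.Nonempty.csSup_mem (Set.Nonempty.image _ ?_) hfin,
    fun x hx => le_csSup hfin.bddAbove hx⟩
  refine IsAlgClosed.exists_root _ ?_
  rw [degree_map, Matrix.charpoly_degree_eq_dim]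
  simpa using hn

open scoped Matrix.Norms.Operator in
theorem eventually_norm_le_of_charpoly_isRoot {X : Type*} [TopologicalSpace X] {n : ℕ}
    {A : X → Matrix (Fin n) (Fin n) ℝ} {x₀ : X} (hA : ContinuousAt A x₀) :
    ∃ R : ℝ, ∀ᶠ x in 𝓝 x₀, ∀ z : ℂ, ((A x).charpoly.map (algebraMap ℝ ℂ)).IsRoot z → ‖z‖ ≤ R := by
  have hc : ContinuousAt (fun x => ‖(A x).map (algebraMap ℝ ℂ)‖ * ‖(1 : Matrix (Fin n) (Fin n) ℂ)‖)
      x₀ := by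
    have hmap : ContinuousAt (fun x => (A x).map (algebraMap ℝ ℂ)) x₀ :=
      (continuous_id.matrix_map (continuous_algebraMap ℝ ℂ)).continuousAt.comp hA
    exact hmap.norm.mul_const _
  obtain ⟨R, hR⟩ := exists_gt (‖(A x₀).map (algebraMap ℝ ℂ)‖ * ‖(1 : Matrix (Fin n) (Fin n) ℂ)‖)
  refine ⟨R, ?_⟩
  filter_upwards [Tendsto.eventually_le_const hR hc] with x hx z hz
  rw [← Matrix.charpoly_map] at hz
  exact (spectrum.norm_le_norm_mul_of_mem (Matrix.mem_spectrum_of_isRoot_charpoly hz)).trans hx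

/-- if every active eigenvalue of `A δ₀` is a simple root of the characteristic
polynomial, then `δ ↦ −α(A δ)` is upper-C¹ at `δ₀`. -/
theorem neg_specAbscissa_upperC1At (m n : ℕ)
    (A : EuclideanSpace ℝ (Fin m) → Matrix (Fin n) (Fin n) ℝ)
    (hA : ∀ i j, ContDiff ℝ 1 fun δ => A δ i j)
    (δ₀ : EuclideanSpace ℝ (Fin m))
    (hactive : ∀ z : ℂ, ((A δ₀).charpoly.map (algebraMap ℝ ℂ)).IsRoot z →
      z.re = specAbscissa (A δ₀) →
      Polynomial.rootMultiplicity z ((A δ₀).charpoly.map (algebraMap ℝ ℂ)) = 1) :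
    UpperC1At m (fun δ => -(specAbscissa (A δ))) δ₀ := by
  simp only [UpperC1At, neg_neg]
  rcases eq_or_ne n 0 with rfl | hn
  · refine LowerC1At.of_isGreatest_range (fun (_ : Unit) _ => 0) (fun _ => contDiffAt_const)
      (Eventually.of_forall fun δ => ?_)
    simp [specAbscissa, Matrix.charpoly]
  set ι : Type := {z : ℂ // ((A δ₀).charpoly.map (algebraMap ℝ ℂ)).IsRoot z ∧
    z.re = specAbscissa (A δ₀)}
  have : Finite ι := ((finite_charpoly_roots (A δ₀)).subset fun z hz => hz.1).to_subtype
  obtain ⟨z₀, hz₀, hz₀'⟩ := (isGreatest_specAbscissa hn (A δ₀)).1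
  let k₀ : ι := ⟨z₀, hz₀, hz₀'⟩
  have : Nonempty ι := ⟨k₀⟩
  have hP := contDiff_eval_charpoly hA
  have himp : ∀ k : ι, _ := fun k => hP.contDiffAt.exists_implicit_complex
    (x₀ := δ₀) (z₀ := k.1) k.2.1
    (((A δ₀).charpoly.map (algebraMap ℝ ℂ)).hasDerivAt k.1)
    (eval_derivative_ne_zero_of_rootMultiplicity_eq_one (hactive k.1 k.2.1 k.2.2))
  choose φ hφ hφ₀ hφroot hφuniq using himp
  have hlocal : ∀ z : ℂ, ∀ᶠ p : EuclideanSpace ℝ (Fin m) × ℂ in 𝓝 (δ₀, z),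
      ((A p.1).charpoly.map (algebraMap ℝ ℂ)).IsRoot p.2 → ∃ k, p.2.re ≤ (φ k p.1).re := by
    intro z
    by_cases hz : ((A δ₀).charpoly.map (algebraMap ℝ ℂ)).IsRoot z
    · rcases ((isGreatest_specAbscissa hn (A δ₀)).2 ⟨z, hz, rfl⟩).eq_or_lt with hre | hre
      · filter_upwards [hφuniq ⟨z, hz, hre⟩] with p hp hroot
        exact ⟨_, (congrArg Complex.re (hp hroot)).ge⟩
      · have hcont : ContinuousAt (fun p : EuclideanSpace ℝ (Fin m) × ℂ => (φ k₀ p.1).re)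
            (δ₀, z) :=
          Complex.continuous_re.continuousAt.comp
            (ContinuousAt.comp (x := (δ₀, z)) (hφ k₀).continuousAt continuousAt_fst)
        have hlt : (fun p : EuclideanSpace ℝ (Fin m) × ℂ => p.2.re) (δ₀, z) <
            (φ k₀ (δ₀, z).1).re := by
          simpa [hφ₀, k₀, hz₀'] using hre
        filter_upwards [ContinuousAt.eventually_lt
          (Complex.continuous_re.comp continuous_snd).continuousAt hcont hlt] with p hp _
        exact ⟨k₀, hp.le⟩
    · filter_upwards [hP.continuous.continuousAt.eventually_ne hz] with p hp hroot
      exact absurd hroot hp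
  obtain ⟨R, hR⟩ := eventually_norm_le_of_charpoly_isRoot
    (continuousAt_pi.2 fun i => continuousAt_pi.2 fun j => (hA i j).continuous.continuousAt)
  have hcpt : ∀ᶠ δ in 𝓝 δ₀, ∀ z ∈ Metric.closedBall (0 : ℂ) R,
      ((A δ).charpoly.map (algebraMap ℝ ℂ)).IsRoot z → ∃ k, z.re ≤ (φ k δ).re :=
    (isCompact_closedBall (0 : ℂ) R).eventually_forall_of_forall_eventually
      fun z _ => hlocal z
  refine LowerC1At.of_isGreatest_range (fun k δ => (φ k δ).re)
    (fun k => Complex.reCLM.contDiff.contDiffAt.comp δ₀ (hφ k)) ?_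
  filter_upwards [hR, hcpt, eventually_all.2 hφroot] with δ hδR hδ hroot
  have hα := isGreatest_specAbscissa hn (A δ)
  have hle : ∀ k, (φ k δ).re ≤ specAbscissa (A δ) := fun k => hα.2 ⟨_, hroot k, rfl⟩
  refine ⟨?_, Set.forall_mem_range.2 hle⟩
  obtain ⟨z, hz, hzre⟩ := hα.1
  obtain ⟨k, hk⟩ := hδ z (by simpa using hδR z hz) hz
  exact ⟨k, (hle k).antisymm (hzre ▸ hk)⟩

end
end

section
/- Let A : ℝ^m → ℂ^{n×n} be a continuously differentiable matrix-valued map, δ₀ ∈ ℝ^m, and let λ₀ ∈ ℂ be a simple root of the characteristic polynomial of A(δ₀). Then there exist an open neighborhood U of δ₀ and a continuously differentiable map λ : U → ℂ such that λ(δ₀) = λ₀ and, for every δ ∈ U, λ(δ) is a simple root of the characteristic polynomial of A(δ). -/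
noncomputable section

open Polynomial Filter Topology

theorem Polynomial.rootMultiplicity_eq_one_iff {R : Type*} [CommRing R] {p : R[X]} (hp : p ≠ 0)
    (t : R) :
    p.rootMultiplicity t = 1 ↔ p.eval t = 0 ∧ (derivative p).eval t ≠ 0 := by
  have h₀ := rootMultiplicity_pos hp (x := t)
  have h₁ := one_lt_rootMultiplicity_iff_isRoot hp (t := t)
  simp only [IsRoot.def] at h₀ h₁
  grind

theorem ContDiff.polynomial_eval {E : Type*} [NormedAddCommGroup E] [NormedSpace ℝ E]
    {k : WithTop ℕ∞} {p : E → ℂ[X]} {d : ℕ} (hd : ∀ x, (p x).natDegree ≤ d)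
    (hp : ∀ i, ContDiff ℝ k fun x => (p x).coeff i) :
    ContDiff ℝ k fun v : E × ℂ => (p v.1).eval v.2 := by
  simp only [fun x => eval_eq_sum_range' (Nat.lt_succ_of_le (hd x))]
  exact ContDiff.sum fun i _ => ((hp i).comp contDiff_fst).mul (contDiff_snd.pow i)

theorem ContDiff.mvPolynomial_eval {E σ : Type*} [NormedAddCommGroup E] [NormedSpace ℝ E]
    {k : WithTop ℕ∞} {f : E → σ → ℂ} (hf : ∀ i, ContDiff ℝ k fun x => f x i)
    (q : MvPolynomial σ ℂ) : ContDiff ℝ k fun x => MvPolynomial.eval (f x) q := by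
  induction q using MvPolynomial.induction_on with
  | C a => simpa using contDiff_const
  | add q r hq hr => simpa using hq.add hr
  | mul_X q i hq => simpa using hq.mul (hf i)

theorem ContDiff.charpoly_coeff {E ι : Type*} [NormedAddCommGroup E] [NormedSpace ℝ E]
    [Fintype ι] [DecidableEq ι] {k : WithTop ℕ∞} {A : E → Matrix ι ι ℂ}
    (hA : ∀ i j, ContDiff ℝ k fun x => A x i j) (l : ℕ) :
    ContDiff ℝ k fun x => (A x).charpoly.coeff l := by
  have h (x : E) : (A x).charpoly.coeff l =
      MvPolynomial.eval (fun ij : ι × ι => A x ij.1 ij.2)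
        ((Matrix.charpoly.univ ℂ ι).coeff l) :=
    (Matrix.charpoly.univ_coeff_eval₂Hom ι (RingHom.id ℂ)
      (fun ij => A x ij.1 ij.2) l).symm
  simp only [h]
  exact ContDiff.mvPolynomial_eval (f := fun x (ij : ι × ι) => A x ij.1 ij.2)
    (fun ij => hA ij.1 ij.2) _

/-- A simple root of a `C¹` family of nonzero complex polynomials of bounded degree persists
locally as a `C¹` branch of simple roots. -/
theorem exists_contDiffOn_simple_root {E : Type*} [NormedAddCommGroup E] [NormedSpace ℝ E]
    [CompleteSpace E] {p : E → ℂ[X]} {d : ℕ} (hd : ∀ x, (p x).natDegree ≤ d)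
    (hp : ∀ i, ContDiff ℝ 1 fun x => (p x).coeff i) (hp₀ : ∀ x, p x ≠ 0)
    {x₀ : E} {z₀ : ℂ} (hz₀ : (p x₀).rootMultiplicity z₀ = 1) :
    ∃ U : Set E, IsOpen U ∧ x₀ ∈ U ∧ ∃ z : E → ℂ, ContDiffOn ℝ 1 z U ∧ z x₀ = z₀ ∧
      ∀ x ∈ U, (p x).rootMultiplicity (z x) = 1 := by
  simp only [fun x => rootMultiplicity_eq_one_iff (hp₀ x)] at hz₀ ⊢
  obtain ⟨hroot, hderiv⟩ := hz₀
  set f : E × ℂ → ℂ := fun v => (p v.1).eval v.2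
  have hf : ContDiff ℝ 1 f := ContDiff.polynomial_eval hd hp
  have hf' : Continuous fun v : E × ℂ => (derivative (p v.1)).eval v.2 := by
    refine (ContDiff.polynomial_eval (k := 1) (d := d)
      (fun x => (natDegree_derivative_le _).trans ((Nat.sub_le _ _).trans (hd x)))
      fun i => ?_).continuous
    simp only [coeff_derivative]
    exact (hp (i + 1)).mul contDiff_const
  have hf₀ : ContDiffAt ℝ 1 f (x₀, z₀) := hf.contDiffAt
  have hinv : (fderiv ℝ f (x₀, z₀) ∘L .inr ℝ E ℂ).IsInvertible := by
    have h₁ : HasFDerivAt (fun z => f (x₀, z)) (fderiv ℝ f (x₀, z₀) ∘L .inr ℝ E ℂ) z₀ :=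
      (hf₀.differentiableAt one_ne_zero).hasFDerivAt.comp z₀ (hasFDerivAt_prodMk_right x₀ z₀)
    have h₂ := ((p x₀).hasDerivAt z₀).hasFDerivAt.restrictScalars ℝ
    refine ⟨(ContinuousLinearEquiv.unitsEquivAut ℂ (Units.mk0 _ hderiv)).restrictScalars ℝ, ?_⟩
    rw [h₁.unique h₂]
    ext
    simp
  set z := hf₀.implicitFunction one_ne_zero hinv
  have hz : ContDiffAt ℝ 1 z x₀ := hf₀.contDiffAt_implicitFunction one_ne_zero hinv
  have hzx : z x₀ = z₀ := hf₀.implicitFunction_apply_self one_ne_zero hinv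
  have hroots : ∀ᶠ x in 𝓝 x₀, f (x, z x) = f (x₀, z₀) :=
    hf₀.eventually_apply_implicitFunction one_ne_zero hinv
  have hsimple : ∀ᶠ x in 𝓝 x₀, (derivative (p x)).eval (z x) ≠ 0 := by
    have hc : ContinuousAt (fun x => (derivative (p x)).eval (z x)) x₀ :=
      hf'.continuousAt.comp (continuousAt_id.prodMk hz.continuousAt)
    exact hc.eventually_ne (by rwa [hzx])
  obtain ⟨U, hU, hUo, hxU⟩ := eventually_nhds_iff.1
    ((hz.eventually (by simp)).and (hroots.and hsimple))
  exact ⟨U, hUo, hxU, z, fun x hx => (hU x hx).1.contDiffWithinAt, hzx,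
    fun x hx => ⟨(hU x hx).2.1.trans hroot, (hU x hx).2.2⟩⟩

/-- a simple eigenvalue of a continuously differentiable matrix family
persists as a continuously differentiable simple-eigenvalue branch. -/
theorem simple_eigenvalue_C1_branch (m n : ℕ)
    (A : EuclideanSpace ℝ (Fin m) → Matrix (Fin n) (Fin n) ℂ)
    (hA : ∀ i j, ContDiff ℝ 1 fun δ => A δ i j)
    (δ₀ : EuclideanSpace ℝ (Fin m)) (lam₀ : ℂ)
    (hsimple : Polynomial.rootMultiplicity lam₀ (A δ₀).charpoly = 1) :
    ∃ U : Set (EuclideanSpace ℝ (Fin m)), IsOpen U ∧ δ₀ ∈ U ∧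
      ∃ lam : EuclideanSpace ℝ (Fin m) → ℂ, ContDiffOn ℝ 1 lam U ∧ lam δ₀ = lam₀ ∧
        ∀ δ ∈ U, Polynomial.rootMultiplicity (lam δ) (A δ).charpoly = 1 :=
  exists_contDiffOn_simple_root (fun δ => (A δ).charpoly_natDegree_eq_dim.le)
    (ContDiff.charpoly_coeff hA) (fun δ => (A δ).charpoly_monic.ne_zero) hsimple

end
end

section
/- Let A : ℝ^m → ℂ^{n×n} be differentiable at δ₀ ∈ ℝ^m, let λ₀ ∈ ℂ be a simple root of the characteristic polynomial of A(δ₀), and let v, u ∈ ℂ^n satisfy A(δ₀) v = λ₀ v, uᴴ A(δ₀) = λ₀ uᴴ, and uᴴ v = 1. Let λ : U → ℂ be a map on a neighborhood U of δ₀ that is differentiable at δ₀, with λ(δ₀) = λ₀ and with λ(δ) an eigenvalue of A(δ) for every δ ∈ U. Then for each i = 1, …, m, the partial derivative satisfies ∂λ/∂δ_i (δ₀) = uᴴ (∂A/∂δ_i)(δ₀) v. -/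
open Matrix

noncomputable section

open Topology Filter

/-- A left eigenvector for `μ` is also a left eigenvector of the adjugate of `μ - M`, with
eigenvalue the value at `μ` of the characteristic polynomial divided by `X - μ`. -/
lemma vecMul_adjugate_of_left_eigenvector {n : Type*} [Fintype n] [DecidableEq n]
    {M : Matrix n n ℂ} {μ : ℂ} {x : n → ℂ} (hx : x ᵥ* M = μ • x) {q : Polynomial ℂ}
    (hq : M.charpoly = (Polynomial.X - Polynomial.C μ) * q) :
    x ᵥ* (Matrix.scalar n μ - M).adjugate = q.eval μ • x := by
  have hne : ∀ t ∈ ({μ}ᶜ : Set ℂ),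
      x ᵥ* (Matrix.scalar n t - M).adjugate = q.eval t • x := by
    intro t ht
    have ht' : t - μ ≠ 0 := sub_ne_zero.2 ht
    have h₁ : x ᵥ* (Matrix.scalar n t - M) = (t - μ) • x := by
      rw [Matrix.vecMul_sub, hx, sub_smul]
      congr 1
      ext i
      simp [Matrix.scalar_apply, Matrix.vecMul_diagonal, mul_comm]
    have h₂ : (Matrix.scalar n t - M).det = (t - μ) * q.eval t := by
      rw [← Matrix.eval_charpoly, hq]
      simp
    have h₃ := congrArg (x ᵥ* ·) (Matrix.mul_adjugate (Matrix.scalar n t - M))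
    simp only [← Matrix.vecMul_vecMul, h₁, h₂, Matrix.smul_vecMul, Matrix.vecMul_smul,
      Matrix.vecMul_one, mul_smul] at h₃
    exact smul_right_injective _ ht' h₃
  have hcl : Continuous fun t : ℂ => x ᵥ* (Matrix.scalar n t - M).adjugate := by
    have : Continuous fun t : ℂ => Matrix.scalar n t - M := by
      simp only [Matrix.scalar_apply]
      fun_prop
    exact continuous_const.matrix_vecMul this.matrix_adjugate
  have hcr : Continuous fun t : ℂ => q.eval t • x := by fun_prop
  exact congrFun (hcl.ext_on (dense_compl_singleton μ) hcr hne) μ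

/-- If `r ⬝ᵥ w` vanishes near `0`, `r` is continuous at `0` and `w` vanishes at `0`, then
`r 0` annihilates the derivative of `w` at `0`. -/
lemma dotProduct_deriv_eq_zero {n : Type*} [Fintype n] {r w : ℝ → n → ℂ} {w' : n → ℂ}
    (hr : ContinuousAt r 0) (hw : HasDerivAt w w' 0) (hw₀ : w 0 = 0)
    (h : ∀ᶠ t in 𝓝 0, r t ⬝ᵥ w t = 0) : r 0 ⬝ᵥ w' = 0 := by
  have hs := hasDerivAt_iff_tendsto_slope_zero.1 hw
  have hdot : Continuous fun p : (n → ℂ) × (n → ℂ) => p.1 ⬝ᵥ p.2 :=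
    continuous_fst.dotProduct continuous_snd
  have hlim := (hdot.tendsto (r 0, w')).comp
    ((hr.tendsto.mono_left nhdsWithin_le_nhds).prodMk_nhds hs)
  refine tendsto_nhds_unique hlim (tendsto_const_nhds.congr' ?_)
  filter_upwards [h.filter_mono nhdsWithin_le_nhds] with t ht
  simp [hw₀, dotProduct_smul, ht]

/-- derivative of a simple eigenvalue: `∂λ/∂δᵢ(δ₀) = uᴴ (∂A/∂δᵢ)(δ₀) v` for
right/left eigenvectors `v`, `u` normalized by `uᴴ v = 1`. -/
theorem simple_eigenvalue_derivative (m n : ℕ)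
    (A : EuclideanSpace ℝ (Fin m) → Matrix (Fin n) (Fin n) ℂ)
    (δ₀ : EuclideanSpace ℝ (Fin m))
    (hA : ∀ i j, DifferentiableAt ℝ (fun δ => A δ i j) δ₀)
    (lam₀ : ℂ)
    (hsimple : Polynomial.rootMultiplicity lam₀ (A δ₀).charpoly = 1)
    (v u : Fin n → ℂ)
    (hv : (A δ₀).mulVec v = lam₀ • v)
    (hu : Matrix.vecMul (star u) (A δ₀) = lam₀ • (star u))
    (huv : star u ⬝ᵥ v = 1)
    (U : Set (EuclideanSpace ℝ (Fin m))) (hU : U ∈ nhds δ₀)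
    (lam : EuclideanSpace ℝ (Fin m) → ℂ)
    (hlam : DifferentiableAt ℝ lam δ₀) (hlam₀ : lam δ₀ = lam₀)
    (heig : ∀ δ ∈ U, ((A δ).charpoly).IsRoot (lam δ)) :
    ∀ i : Fin m,
      fderiv ℝ lam δ₀ (EuclideanSpace.single i 1) =
        star u ⬝ᵥ
          (Matrix.of fun j k =>
            fderiv ℝ (fun δ => A δ j k) δ₀ (EuclideanSpace.single i 1)).mulVec v := by
  intro i
  set e : EuclideanSpace ℝ (Fin m) := EuclideanSpace.single i 1
  set A' : Matrix (Fin n) (Fin n) ℂ :=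
    Matrix.of fun j k => fderiv ℝ (fun δ => A δ j k) δ₀ e with hA'
  have hp : (A δ₀).charpoly ≠ 0 := (A δ₀).charpoly_monic.ne_zero
  obtain ⟨q, hq, hqn⟩ := Polynomial.exists_eq_pow_rootMultiplicity_mul_and_not_dvd _ hp lam₀
  rw [hsimple, pow_one] at hq
  have hq₀ : q.eval lam₀ ≠ 0 := fun h => hqn (Polynomial.dvd_iff_isRoot.2 h)
  have hline : HasDerivAt (fun t : ℝ => δ₀ + t • e) e 0 := by
    simpa using ((hasDerivAt_id (0 : ℝ)).smul_const e).const_add δ₀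
  have hcomp : ∀ {f : EuclideanSpace ℝ (Fin m) → ℂ}, DifferentiableAt ℝ f δ₀ →
      HasDerivAt (fun t : ℝ => f (δ₀ + t • e)) (fderiv ℝ f δ₀ e) 0 := fun {f} hf =>
    HasFDerivAt.comp_hasDerivAt (0 : ℝ) (by simpa using hf.hasFDerivAt) hline
  let B : ℝ → Matrix (Fin n) (Fin n) ℂ := fun t =>
    Matrix.scalar (Fin n) (lam (δ₀ + t • e)) - A (δ₀ + t • e)
  have hB₀ : B 0 = Matrix.scalar (Fin n) lam₀ - A δ₀ := by simp [B, hlam₀]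
  have hscalar : ∀ (a : ℂ) (x : Fin n → ℂ), Matrix.scalar (Fin n) a *ᵥ x = a • x := by
    intro a x
    ext j
    simp [Matrix.scalar_apply, Matrix.mulVec_diagonal]
  have hBc : ContinuousAt B 0 := by
    refine continuousAt_pi.2 fun j => continuousAt_pi.2 fun k => ?_
    simp only [B, Matrix.sub_apply, Matrix.scalar_apply, Matrix.diagonal_apply]
    refine ContinuousAt.sub ?_ (hcomp (hA j k)).continuousAt
    split_ifs
    exacts [(hcomp hlam).continuousAt, continuousAt_const]
  have hr : ContinuousAt (fun t => star u ᵥ* (B t).adjugate) 0 :=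
    ((continuous_const.matrix_vecMul continuous_id.matrix_adjugate).continuousAt).comp hBc
  have hw : HasDerivAt (fun t => B t *ᵥ v) (fderiv ℝ lam δ₀ e • v - A' *ᵥ v) 0 := by
    simp only [B, Matrix.sub_mulVec, hscalar]
    refine ((hcomp hlam).smul_const v).sub (hasDerivAt_pi.2 fun j => ?_)
    simp only [Matrix.mulVec, dotProduct, hA', Matrix.of_apply]
    exact HasDerivAt.fun_sum fun k _ => (hcomp (hA j k)).mul_const (v k)
  have hw₀ : B 0 *ᵥ v = 0 := by
    rw [hB₀, Matrix.sub_mulVec, hv, hscalar, sub_self]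
  have hev : ∀ᶠ t in 𝓝 (0 : ℝ), (star u ᵥ* (B t).adjugate) ⬝ᵥ (B t *ᵥ v) = 0 := by
    have hU' : ∀ᶠ t in 𝓝 (0 : ℝ), δ₀ + t • e ∈ U :=
      hline.continuousAt.eventually_mem (by simpa using hU)
    filter_upwards [hU'] with t ht
    have hdet : (B t).det = 0 := by
      rw [← Matrix.eval_charpoly]
      exact heig _ ht
    rw [Matrix.dotProduct_mulVec, Matrix.vecMul_vecMul, Matrix.adjugate_mul, hdet]
    simp
  have key := dotProduct_deriv_eq_zero hr hw hw₀ hev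
  rw [hB₀, vecMul_adjugate_of_left_eigenvector hu hq, smul_dotProduct, smul_eq_mul,
    dotProduct_sub, dotProduct_smul, huv, smul_eq_mul, mul_one] at key
  exact sub_eq_zero.1 ((mul_eq_zero.1 key).resolve_left hq₀)

end
end

section
/- Let M : ℝ^m → ℂ^{p×q} be a continuously differentiable matrix-valued map and δ₀ ∈ ℝ^m. Suppose σ̄(M(δ₀)) > 0 and σ̄(M(δ₀))² is a simple root of the characteristic polynomial of M(δ₀)ᴴ M(δ₀). Let u ∈ ℂ^p and v ∈ ℂ^q be unit vectors with M(δ₀) v = σ̄(M(δ₀)) u and M(δ₀)ᴴ u = σ̄(M(δ₀)) v. Then the function δ ↦ σ̄(M(δ)) is differentiable at δ₀, and for each i = 1, …, m its partial derivative is ∂σ̄(M(δ))/∂δ_i |_{δ=δ₀} = Re ( uᴴ (∂M/∂δ_i)(δ₀) v ). -/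
open Matrix

noncomputable section

/-- The largest singular value of a complex matrix: the operator norm of the associated
linear map between Euclidean spaces. -/
def sigmaMax {p q : ℕ} (G : Matrix (Fin p) (Fin q) ℂ) : ℝ :=
  ‖LinearMap.toContinuousLinearMap (Matrix.toEuclideanLin G)‖

open scoped InnerProductSpace

section

variable {E F : Type*} [NormedAddCommGroup E] [InnerProductSpace ℂ E]
  [NormedAddCommGroup F] [InnerProductSpace ℂ F]

/-- The real-linear functional `H ↦ Re ⟪u, H v⟫` on bounded operators. -/
def reInnerApplyCLM (u : F) (v : E) : (E →L[ℂ] F) →L[ℝ] ℝ :=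
  Complex.reCLM ∘L
    ((innerSL ℂ u) ∘L (ContinuousLinearMap.apply ℂ F v)).restrictScalars ℝ

@[simp]
lemma reInnerApplyCLM_apply (u : F) (v : E) (H : E →L[ℂ] F) :
    reInnerApplyCLM u v H = (⟪u, H v⟫_ℂ).re := by
  simp [reInnerApplyCLM]

lemma le_opNorm_add_of_singular_pair {A : E →L[ℂ] F} {u : F} {v : E} (hu : ‖u‖ = 1)
    (hv : ‖v‖ = 1) (hAv : A v = (‖A‖ : ℂ) • u) (H : E →L[ℂ] F) :
    ‖A‖ + (⟪u, H v⟫_ℂ).re ≤ ‖A + H‖ := by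
  have h1 : (⟪u, (A + H) v⟫_ℂ).re = ‖A‖ + (⟪u, H v⟫_ℂ).re := by
    rw [_root_.add_apply, hAv, inner_add_right, inner_smul_right,
      inner_self_eq_norm_sq_to_K, hu]
    simp
  calc _ = (⟪u, (A + H) v⟫_ℂ).re := h1.symm
    _ ≤ ‖u‖ * ‖(A + H) v‖ := re_inner_le_norm (𝕜 := ℂ) u ((A + H) v)
    _ ≤ ‖A + H‖ := by
      rw [hu, one_mul]
      simpa [hv] using (A + H).le_opNorm v

lemma norm_add_apply_sq_le {A : E →L[ℂ] F} {u : F} {v : E} (hu : ‖u‖ = 1)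
    (hv : ‖v‖ = 1) (hAv : A v = (‖A‖ : ℂ) • u)
    (hAu : ∀ x, ⟪u, A x⟫_ℂ = (‖A‖ : ℂ) * ⟪v, x⟫_ℂ) {g : ℝ} (hg : 0 < g)
    (hgap : ∀ w, ⟪v, w⟫_ℂ = 0 → ‖A w‖ ^ 2 ≤ (‖A‖ ^ 2 - g) * ‖w‖ ^ 2)
    (H : E →L[ℂ] F) (x : E) :
    ‖(A + H) x‖ ^ 2 ≤ (‖A‖ ^ 2 + 2 * (‖A‖ * (⟪u, H v⟫_ℂ).re)
      + (1 + 9 * ‖A‖ ^ 2 / g) * ‖H‖ ^ 2) * ‖x‖ ^ 2 := by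
  set s := ‖A‖ with hs
  set a : ℂ := ⟪v, x⟫_ℂ with ha
  set w : E := x - a • v with hw
  have hx : x = a • v + w := by simp [hw]
  have hvw : ⟪v, w⟫_ℂ = 0 := by
    rw [hw, inner_sub_right, inner_smul_right, inner_self_eq_norm_sq_to_K, hv]
    simp [ha]
  have huw : ⟪u, A w⟫_ℂ = 0 := by rw [hAu, hvw, mul_zero]
  have hnx : ‖x‖ ^ 2 = ‖a‖ ^ 2 + ‖w‖ ^ 2 := by
    rw [hx, @norm_add_sq ℂ, inner_smul_left, hvw, norm_smul, hv]
    simp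
  have hAx : A x = (a * s) • u + A w := by
    rw [hx, map_add, map_smul, hAv, smul_smul]
  have hnAx : ‖A x‖ ^ 2 = ‖a‖ ^ 2 * s ^ 2 + ‖A w‖ ^ 2 := by
    rw [hAx, @norm_add_sq ℂ, inner_smul_left, huw, norm_smul, hu]
    simp [mul_pow, hs]
  have hwx : ‖w‖ ≤ ‖x‖ := by
    apply le_of_sq_le_sq _ (norm_nonneg x)
    nlinarith [sq_nonneg ‖a‖]
  have hax : ‖a‖ ≤ ‖x‖ := by
    apply le_of_sq_le_sq _ (norm_nonneg x)
    nlinarith [sq_nonneg ‖w‖]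
  have hHx : ‖H x‖ ≤ ‖H‖ * ‖x‖ := H.le_opNorm x
  have hs0 : 0 ≤ s := norm_nonneg A
  have hH0 : 0 ≤ ‖H‖ := norm_nonneg H
  set L : ℝ := (⟪u, H v⟫_ℂ).re with hL
  have hLH : -‖H‖ ≤ L := by
    have h1 : |L| ≤ ‖u‖ * ‖H v‖ := (Complex.abs_re_le_norm _).trans (norm_inner_le_norm u (H v))
    have h2 : ‖H v‖ ≤ ‖H‖ := by simpa [hv] using H.le_opNorm v
    rw [hu, one_mul] at h1
    linarith [neg_abs_le L]
  have hcross : (⟪A x, H x⟫_ℂ).re ≤ ‖a‖ ^ 2 * (s * L) + 2 * (s * ‖H‖ * ‖w‖ * ‖x‖) := by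
    have h1 : ⟪A x, H x⟫_ℂ = ((‖a‖ ^ 2 * s : ℝ) : ℂ) * ⟪u, H v⟫_ℂ
        + ⟪(a * s) • u, H w⟫_ℂ + ⟪A w, H x⟫_ℂ := by
      rw [hAx, inner_add_left]
      congr 1
      conv_lhs => rw [hx]
      rw [map_add, inner_add_right, map_smul, inner_smul_left, inner_smul_right]
      congr 1
      have : (starRingEnd ℂ) a * a = ((‖a‖ ^ 2 : ℝ) : ℂ) := by
        rw [Complex.conj_mul']; push_cast; rfl
      rw [map_mul, Complex.conj_ofReal]
      push_cast at this ⊢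
      rw [← this]
      ring
    have h2 : (⟪(a * s) • u, H w⟫_ℂ).re ≤ s * ‖H‖ * ‖w‖ * ‖x‖ := by
      calc _ ≤ ‖(a * (s : ℂ)) • u‖ * ‖H w‖ := re_inner_le_norm (𝕜 := ℂ) _ _
        _ = ‖a‖ * s * ‖H w‖ := by
          rw [norm_smul, hu, norm_mul, Complex.norm_of_nonneg hs0, mul_one]
        _ ≤ ‖x‖ * s * (‖H‖ * ‖w‖) := by gcongr; exact H.le_opNorm w
        _ = _ := by ring
    have h3 : (⟪A w, H x⟫_ℂ).re ≤ s * ‖H‖ * ‖w‖ * ‖x‖ := by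
      calc _ ≤ ‖A w‖ * ‖H x‖ := re_inner_le_norm (𝕜 := ℂ) _ _
        _ ≤ (s * ‖w‖) * (‖H‖ * ‖x‖) := by gcongr; exact A.le_opNorm w
        _ = _ := by ring
    rw [h1, Complex.add_re, Complex.add_re, Complex.re_ofReal_mul]
    linarith
  have hexp : ‖(A + H) x‖ ^ 2 = ‖A x‖ ^ 2 + 2 * (⟪A x, H x⟫_ℂ).re + ‖H x‖ ^ 2 := by
    rw [_root_.add_apply, @norm_add_sq ℂ]; rfl
  have hHx2 : ‖H x‖ ^ 2 ≤ ‖H‖ ^ 2 * ‖x‖ ^ 2 := by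
    rw [← mul_pow]; gcongr
  have hwL : -(‖w‖ ^ 2 * (s * L)) ≤ s * ‖H‖ * ‖w‖ * ‖x‖ := by
    have h1 : -(‖w‖ ^ 2 * (s * L)) ≤ ‖w‖ ^ 2 * (s * ‖H‖) := by
      have := mul_le_mul_of_nonneg_left hLH (mul_nonneg (sq_nonneg ‖w‖) hs0)
      linarith
    have h2 : ‖w‖ * (s * ‖H‖ * ‖w‖) ≤ ‖x‖ * (s * ‖H‖ * ‖w‖) := by gcongr
    linarith
  have hamgm : 6 * (s * ‖H‖ * ‖w‖ * ‖x‖) - g * ‖w‖ ^ 2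
      ≤ 9 * s ^ 2 / g * ‖H‖ ^ 2 * ‖x‖ ^ 2 := by
    have : 9 * s ^ 2 / g * ‖H‖ ^ 2 * ‖x‖ ^ 2
        - (6 * (s * ‖H‖ * ‖w‖ * ‖x‖) - g * ‖w‖ ^ 2)
        = (3 * s * ‖H‖ * ‖x‖ - g * ‖w‖) ^ 2 / g := by
      field_simp
      ring
    have h2 : 0 ≤ (3 * s * ‖H‖ * ‖x‖ - g * ‖w‖) ^ 2 / g := by positivity
    linarith
  have hAw := hgap w hvw
  have hna : ‖a‖ ^ 2 = ‖x‖ ^ 2 - ‖w‖ ^ 2 := by linarith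
  rw [hexp, hnAx]
  rw [hna] at hcross ⊢
  linarith

lemma opNorm_add_le_of_gap {A : E →L[ℂ] F} {u : F} {v : E} (hA : 0 < ‖A‖) (hu : ‖u‖ = 1)
    (hv : ‖v‖ = 1) (hAv : A v = (‖A‖ : ℂ) • u)
    (hAu : ∀ x, ⟪u, A x⟫_ℂ = (‖A‖ : ℂ) * ⟪v, x⟫_ℂ) {g : ℝ} (hg : 0 < g)
    (hgap : ∀ w, ⟪v, w⟫_ℂ = 0 → ‖A w‖ ^ 2 ≤ (‖A‖ ^ 2 - g) * ‖w‖ ^ 2)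
    (H : E →L[ℂ] F) :
    ‖A + H‖ ≤ ‖A‖ + (⟪u, H v⟫_ℂ).re + (1 + 9 * ‖A‖ ^ 2 / g) / (2 * ‖A‖) * ‖H‖ ^ 2 := by
  set K : ℝ := ‖A‖ ^ 2 + 2 * (‖A‖ * (⟪u, H v⟫_ℂ).re) + (1 + 9 * ‖A‖ ^ 2 / g) * ‖H‖ ^ 2 with hK
  have hb := norm_add_apply_sq_le hu hv hAv hAu hg hgap H
  have hK0 : 0 ≤ K := by
    have := hb v
    rw [hv, one_pow, mul_one] at this
    exact (sq_nonneg _).trans this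
  have h1 : ‖A + H‖ ≤ √K := by
    refine ContinuousLinearMap.opNorm_le_bound _ (Real.sqrt_nonneg K) fun x => ?_
    apply le_of_sq_le_sq _ (by positivity)
    rw [mul_pow, Real.sq_sqrt hK0]
    exact hb x
  have h2 : 2 * ‖A‖ * √K ≤ ‖A‖ ^ 2 + K := by
    have := two_mul_le_add_sq ‖A‖ (√K)
    rwa [Real.sq_sqrt hK0] at this
  have h3 : √K ≤ (‖A‖ ^ 2 + K) / (2 * ‖A‖) := by
    rw [le_div_iff₀ (by positivity)]
    linarith
  have h4 : (‖A‖ ^ 2 + K) / (2 * ‖A‖) = ‖A‖ + (⟪u, H v⟫_ℂ).re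
      + (1 + 9 * ‖A‖ ^ 2 / g) / (2 * ‖A‖) * ‖H‖ ^ 2 := by
    rw [hK]
    field_simp
    ring
  linarith

/-- The operator norm is differentiable at an operator whose largest singular value is
separated from the rest of the spectrum. -/
lemma hasFDerivAt_opNorm_of_gap {A : E →L[ℂ] F} {u : F} {v : E} (hA : 0 < ‖A‖) (hu : ‖u‖ = 1)
    (hv : ‖v‖ = 1) (hAv : A v = (‖A‖ : ℂ) • u)
    (hAu : ∀ x, ⟪u, A x⟫_ℂ = (‖A‖ : ℂ) * ⟪v, x⟫_ℂ) {g : ℝ} (hg : 0 < g)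
    (hgap : ∀ w, ⟪v, w⟫_ℂ = 0 → ‖A w‖ ^ 2 ≤ (‖A‖ ^ 2 - g) * ‖w‖ ^ 2) :
    HasFDerivAt (fun B : E →L[ℂ] F => ‖B‖) (reInnerApplyCLM u v) A := by
  rw [hasFDerivAt_iff_isLittleO_nhds_zero]
  refine Asymptotics.IsBigO.trans_isLittleO (g := fun H : E →L[ℂ] F => ‖H‖ ^ 2) ?_
    (Asymptotics.isLittleO_norm_pow_id one_lt_two)
  refine Asymptotics.IsBigO.of_bound ((1 + 9 * ‖A‖ ^ 2 / g) / (2 * ‖A‖))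
    (Filter.Eventually.of_forall fun H => ?_)
  have h1 := le_opNorm_add_of_singular_pair hu hv hAv H
  have h2 := opNorm_add_le_of_gap hA hu hv hAv hAu hg hgap H
  rw [reInnerApplyCLM_apply, Real.norm_eq_abs, abs_of_nonneg (by linarith), norm_pow, norm_norm]
  linarith

lemma adjoint_apply_apply_of_norm_eq [CompleteSpace E] [CompleteSpace F] {A : E →L[ℂ] F} {w : E}
    (hw : ‖A w‖ = ‖A‖ * ‖w‖) : A.adjoint (A w) = ((‖A‖ : ℂ) ^ 2) • w := by
  rw [← sub_eq_zero, ← norm_le_zero_iff]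
  apply le_of_sq_le_sq _ le_rfl
  have h1 : ‖A.adjoint (A w)‖ ^ 2 ≤ (‖A‖ * (‖A‖ * ‖w‖)) ^ 2 := by
    have := A.adjoint.le_opNorm (A w)
    rw [LinearIsometryEquiv.norm_map, hw] at this
    gcongr
  have h2 : RCLike.re ⟪A.adjoint (A w), ((‖A‖ : ℂ) ^ 2) • w⟫_ℂ = ‖A‖ ^ 2 * ‖A w‖ ^ 2 := by
    rw [inner_smul_right, ContinuousLinearMap.adjoint_inner_left, inner_self_eq_norm_sq_to_K]
    norm_cast
    exact Complex.re_ofReal_mul _ _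
  have h3 : ‖((‖A‖ : ℂ) ^ 2) • w‖ = ‖A‖ ^ 2 * ‖w‖ := by
    rw [norm_smul, norm_pow, Complex.norm_of_nonneg (norm_nonneg A)]
  rw [@norm_sub_sq ℂ, h2, h3, hw]
  linarith

/-- In finite dimension, strict inequality on the orthogonal complement of `v` upgrades to a
uniform gap. -/
lemma exists_gap_of_forall_lt [FiniteDimensional ℂ E] {A : E →L[ℂ] F} {v : E}
    (h : ∀ w, ⟪v, w⟫_ℂ = 0 → w ≠ 0 → ‖A w‖ < ‖A‖ * ‖w‖) (hA : 0 < ‖A‖) :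
    ∃ g : ℝ, 0 < g ∧ ∀ w, ⟪v, w⟫_ℂ = 0 → ‖A w‖ ^ 2 ≤ (‖A‖ ^ 2 - g) * ‖w‖ ^ 2 := by
  have : ProperSpace E := FiniteDimensional.proper ℂ E
  let S : Set E := Metric.sphere 0 1 ∩ {w | ⟪v, w⟫_ℂ = 0}
  have hS : IsCompact S := (isCompact_sphere (0 : E) 1).inter_right
    (isClosed_eq (by fun_prop) continuous_const)
  have hmem : ∀ w, ⟪v, w⟫_ℂ = 0 → w ≠ 0 → ((‖w‖⁻¹ : ℝ) : ℂ) • w ∈ S := by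
    intro w hw hw0
    have : ‖w‖ ≠ 0 := norm_ne_zero_iff.mpr hw0
    refine ⟨?_, ?_⟩
    · simp [norm_smul, this]
    · simp [hw]
  obtain ⟨t, ht0, htA, ht⟩ : ∃ t : ℝ, 0 ≤ t ∧ t < ‖A‖ ∧ ∀ w ∈ S, ‖A w‖ ≤ t := by
    rcases S.eq_empty_or_nonempty with hE | hne
    · exact ⟨0, le_rfl, hA, by simp [hE]⟩
    · obtain ⟨w₀, hw₀, hmax⟩ := hS.exists_isMaxOn hne (f := fun w => ‖A w‖) (by fun_prop)
      have hn : ‖w₀‖ = 1 := by simpa using hw₀.1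
      refine ⟨‖A w₀‖, norm_nonneg _, ?_, fun w hw => hmax hw⟩
      simpa [hn] using h w₀ hw₀.2 (norm_ne_zero_iff.mp (by simp [hn]))
  refine ⟨‖A‖ ^ 2 - t ^ 2, by nlinarith, fun w hw => ?_⟩
  rcases eq_or_ne w 0 with rfl | hw0
  · simp
  have h1 := ht _ (hmem w hw hw0)
  have hpos : 0 < ‖w‖ := norm_pos_iff.mpr hw0
  rw [map_smul, norm_smul, Complex.norm_of_nonneg (by positivity), inv_mul_le_iff₀ hpos] at h1
  calc ‖A w‖ ^ 2 ≤ (‖w‖ * t) ^ 2 := by gcongr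
    _ = _ := by ring

end

/-- The real-linear map sending an array of entries to the operator it defines between Euclidean
spaces. -/
def euclideanOperatorCLM (p q : ℕ) :
    (Fin p → Fin q → ℂ) →L[ℝ] (EuclideanSpace ℂ (Fin q) →L[ℂ] EuclideanSpace ℂ (Fin p)) :=
  LinearMap.toContinuousLinearMap
    ((LinearMap.toContinuousLinearMap.toLinearMap ∘ₗ
      (Matrix.toEuclideanLin (𝕜 := ℂ) (m := Fin p) (n := Fin q)).toLinearMap ∘ₗ
      (Matrix.ofLinearEquiv ℂ).toLinearMap).restrictScalars ℝ)

lemma euclideanOperatorCLM_apply {p q : ℕ} (G : Fin p → Fin q → ℂ) :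
    euclideanOperatorCLM p q G =
      LinearMap.toContinuousLinearMap (Matrix.toEuclideanLin (Matrix.of G)) := rfl

/-- A simple root of the characteristic polynomial has an eigenspace of dimension at most one. -/
lemma Matrix.exists_smul_eq_of_rootMultiplicity_eq_one {n : Type*} [Fintype n] [DecidableEq n]
    {B : Matrix n n ℂ} {μ : ℂ} (h : B.charpoly.rootMultiplicity μ = 1) {v w : n → ℂ}
    (hv0 : v ≠ 0) (hv : B *ᵥ v = μ • v) (hw : B *ᵥ w = μ • w) : ∃ c : ℂ, c • v = w := by
  have h1 : Module.finrank ℂ (Module.End.eigenspace B.toLin' μ) ≤ 1 := by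
    have := LinearMap.finrank_eigenspace_le B.toLin' μ
    rwa [Matrix.charpoly_toLin', h] at this
  have hv' : v ∈ Module.End.eigenspace B.toLin' μ := by
    simpa [Module.End.mem_eigenspace_iff] using hv
  have hw' : w ∈ Module.End.eigenspace B.toLin' μ := by
    simpa [Module.End.mem_eigenspace_iff] using hw
  obtain ⟨e, he⟩ := finrank_le_one_iff.mp h1
  obtain ⟨a, ha⟩ := he ⟨v, hv'⟩
  obtain ⟨b, hb⟩ := he ⟨w, hw'⟩
  have ha' : a • (e : n → ℂ) = v := congrArg Subtype.val ha
  have hb' : b • (e : n → ℂ) = w := congrArg Subtype.val hb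
  have ha0 : a ≠ 0 := by
    rintro rfl
    exact hv0 (by rw [← ha', zero_smul])
  exact ⟨b / a, by rw [← ha', ← hb', smul_smul, div_mul_cancel₀ _ ha0]⟩

/-- derivative of a simple largest singular value:
`∂σ̄(M(δ))/∂δᵢ |_{δ₀} = Re (uᴴ (∂M/∂δᵢ)(δ₀) v)` for unit singular vectors `u`, `v`. -/
theorem sigmaMax_derivative (m p q : ℕ)
    (M : EuclideanSpace ℝ (Fin m) → Matrix (Fin p) (Fin q) ℂ)
    (hM : ∀ i j, ContDiff ℝ 1 fun δ => M δ i j)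
    (δ₀ : EuclideanSpace ℝ (Fin m))
    (hpos : 0 < sigmaMax (M δ₀))
    (hsimple : Polynomial.rootMultiplicity ((sigmaMax (M δ₀) : ℂ) ^ 2)
      ((Matrix.conjTranspose (M δ₀) * M δ₀).charpoly) = 1)
    (u : Fin p → ℂ) (v : Fin q → ℂ)
    (hu : ‖(EuclideanSpace.equiv (Fin p) ℂ).symm u‖ = 1)
    (hv : ‖(EuclideanSpace.equiv (Fin q) ℂ).symm v‖ = 1)
    (hMv : (M δ₀).mulVec v = (sigmaMax (M δ₀) : ℂ) • u)
    (hMu : (Matrix.conjTranspose (M δ₀)).mulVec u = (sigmaMax (M δ₀) : ℂ) • v) :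
    DifferentiableAt ℝ (fun δ => sigmaMax (M δ)) δ₀ ∧
      ∀ i : Fin m,
        fderiv ℝ (fun δ => sigmaMax (M δ)) δ₀ (EuclideanSpace.single i 1) =
          (star u ⬝ᵥ
            (Matrix.of fun j k =>
              fderiv ℝ (fun δ => M δ j k) δ₀ (EuclideanSpace.single i 1)).mulVec v).re := by
  set A := LinearMap.toContinuousLinearMap (Matrix.toEuclideanLin (M δ₀)) with hAdef
  have hs : sigmaMax (M δ₀) = ‖A‖ := rfl
  rw [hs] at hpos hsimple hMv hMu
  have hadj : A.adjoint =
      LinearMap.toContinuousLinearMap (Matrix.toEuclideanLin (M δ₀)ᴴ) := by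
    rw [Matrix.toEuclideanLin_conjTranspose_eq_adjoint]
    rfl
  set u' : EuclideanSpace ℂ (Fin p) := WithLp.toLp 2 u with hu'
  set v' : EuclideanSpace ℂ (Fin q) := WithLp.toLp 2 v with hv'
  have hun : ‖u'‖ = 1 := hu
  have hvn : ‖v'‖ = 1 := hv
  have hAv : A v' = (‖A‖ : ℂ) • u' := congrArg (WithLp.toLp 2) hMv
  have hAu : A.adjoint u' = (‖A‖ : ℂ) • v' := by
    rw [hadj]
    exact congrArg (WithLp.toLp 2) hMu
  have hAu' : ∀ x, ⟪u', A x⟫_ℂ = (‖A‖ : ℂ) * ⟪v', x⟫_ℂ := fun x => by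
    rw [← ContinuousLinearMap.adjoint_inner_left, hAu, inner_smul_left, Complex.conj_ofReal]
  have hlt : ∀ w, ⟪v', w⟫_ℂ = 0 → w ≠ 0 → ‖A w‖ < ‖A‖ * ‖w‖ := by
    intro w hw hw0
    refine lt_of_le_of_ne (A.le_opNorm w) fun heq => hw0 ?_
    have heig := adjoint_apply_apply_of_norm_eq heq
    rw [hadj] at heig
    have hBw : ((M δ₀)ᴴ * M δ₀) *ᵥ w.ofLp = ((‖A‖ : ℂ) ^ 2) • w.ofLp := by
      rw [← Matrix.mulVec_mulVec]
      exact congrArg WithLp.ofLp heig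
    have hBv : ((M δ₀)ᴴ * M δ₀) *ᵥ v = ((‖A‖ : ℂ) ^ 2) • v := by
      rw [← Matrix.mulVec_mulVec, hMv, Matrix.mulVec_smul, hMu, smul_smul, sq]
    have hv0 : v ≠ 0 := by
      rintro rfl
      simp [hv'] at hvn
    obtain ⟨c, hc⟩ := Matrix.exists_smul_eq_of_rootMultiplicity_eq_one hsimple hv0 hBv hBw
    have hcw : w = c • v' := congrArg (WithLp.toLp 2) hc.symm
    rw [hcw, inner_smul_right, inner_self_eq_norm_sq_to_K, hvn] at hw
    have hc0 : c = 0 := by simpa using hw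
    rw [hcw, hc0, zero_smul]
  obtain ⟨g, hg, hgap⟩ := exists_gap_of_forall_lt hlt hpos
  have hnorm := hasFDerivAt_opNorm_of_gap hpos hun hvn hAv hAu' hg hgap
  have hentry : HasFDerivAt (fun δ => fun j k => M δ j k)
      (ContinuousLinearMap.pi fun j => ContinuousLinearMap.pi fun k =>
        fderiv ℝ (fun δ => M δ j k) δ₀) δ₀ :=
    hasFDerivAt_pi.mpr fun j => hasFDerivAt_pi.mpr fun k =>
      ((hM j k).differentiable one_ne_zero δ₀).hasFDerivAt
  have hop := (euclideanOperatorCLM p q).hasFDerivAt.comp δ₀ hentry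
  have hsig : HasFDerivAt (fun δ => sigmaMax (M δ)) _ δ₀ := HasFDerivAt.comp δ₀ hnorm hop
  refine ⟨hsig.differentiableAt, fun i => ?_⟩
  rw [hsig.fderiv]
  simp only [ContinuousLinearMap.comp_apply, reInnerApplyCLM_apply, euclideanOperatorCLM_apply]
  rw [EuclideanSpace.inner_eq_star_dotProduct, dotProduct_comm]
  rfl

end
end

section
/- Every convex function f : ℝ^n → ℝ (finite-valued everywhere) is lower-C¹ at every point x₀ ∈ ℝ^n. -/
noncomputable section

/-- A continuous convex function on a real normed space has a subgradient at every point. -/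
theorem ConvexOn.exists_subgradient {E : Type*} [NormedAddCommGroup E] [NormedSpace ℝ E]
    {f : E → ℝ} (hf : ConvexOn ℝ Set.univ f) (hc : Continuous f) (y : E) :
    ∃ a : E →L[ℝ] ℝ, ∀ x, f y + a (x - y) ≤ f x := by
  have hconv : Convex ℝ {p : E × ℝ | p.1 ∈ Set.univ ∧ f p.1 < p.2} := hf.convex_strict_epigraph
  have hopen : IsOpen {p : E × ℝ | p.1 ∈ Set.univ ∧ f p.1 < p.2} := by
    simpa using isOpen_lt (hc.comp continuous_fst) continuous_snd
  obtain ⟨g, hg⟩ := geometric_hahn_banach_point_open (x := (y, f y)) hconv hopen (by simp)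
  have hsplit (z : E) (t : ℝ) : g (z, t) = g (z, 0) + t * g (0, 1) := by
    rw [← smul_eq_mul, ← map_smul, ← map_add]
    simp
  have hsub (x z : E) : g (x - z, 0) = g (x, 0) - g (z, 0) := by
    rw [← map_sub]
    simp
  have hpos : 0 < g (0, 1) := by
    have h := hg (y, f y + 1) ⟨trivial, by simp⟩
    rw [hsplit y (f y), hsplit y (f y + 1)] at h
    linarith
  refine ⟨-((g (0, 1))⁻¹ • g.comp (ContinuousLinearMap.inl ℝ E ℝ)), fun x => ?_⟩
  refine le_of_forall_gt_imp_ge_of_dense fun t ht => ?_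
  have h := hg (x, t) ⟨trivial, ht⟩
  rw [hsplit y (f y), hsplit x t] at h
  have key : (g (0, 1))⁻¹ * g (x - y, 0) ≥ f y - t := by
    rw [ge_iff_le, inv_mul_eq_div, le_div_iff₀ hpos, hsub]
    linarith
  simp only [neg_apply, smul_apply,
    ContinuousLinearMap.comp_apply, ContinuousLinearMap.inl_apply, smul_eq_mul]
  linarith

/-- A subgradient at a point near which the function is `C`-Lipschitz has norm at most `C`. -/
theorem LipschitzOnWith.norm_subgradient_le {E : Type*} [NormedAddCommGroup E] [NormedSpace ℝ E]
    {f : E → ℝ} {C : NNReal} {t : Set E} {y : E} (hL : LipschitzOnWith C f t)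
    (ht : t ∈ nhds y) {a : E →L[ℝ] ℝ} (ha : ∀ x, f y + a (x - y) ≤ f x) : ‖a‖ ≤ C := by
  have bound {v : E} (hv : y + v ∈ t) : a v ≤ C * ‖v‖ := by
    have h := (Real.dist_eq _ _ ▸ hL.dist_le_mul _ hv _ (mem_of_mem_nhds ht))
    have h' := ha (y + v)
    rw [dist_self_add_left] at h
    rw [add_sub_cancel_left] at h'
    linarith [le_abs_self (f (y + v) - f y)]
  refine ContinuousLinearMap.opNorm_le_of_nhds_zero C.coe_nonneg ?_
  have hplus : ∀ᶠ v in nhds (0 : E), y + v ∈ t :=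
    (by fun_prop : Continuous fun v : E => y + v).continuousAt.eventually_mem (by simpa using ht)
  have hminus : ∀ᶠ v in nhds (0 : E), y + -v ∈ t :=
    (by fun_prop : Continuous fun v : E => y + -v).continuousAt.eventually_mem (by simpa using ht)
  filter_upwards [hplus, hminus] with v hv hv'
  have h := bound hv'
  rw [map_neg, norm_neg] at h
  exact abs_le.2 ⟨by linarith, bound hv⟩

/-- every finite-valued convex function on `ℝⁿ` is lower-C¹ at every point. -/
theorem convexOn_lowerC1At (n : ℕ) (f : EuclideanSpace ℝ (Fin n) → ℝ)
    (hf : ConvexOn ℝ Set.univ f) :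
    ∀ x₀ : EuclideanSpace ℝ (Fin n), LowerC1At n f x₀ := by
  intro x₀
  have hfc : Continuous f := hf.locallyLipschitz.continuous
  obtain ⟨C, t, ht, hL⟩ := hf.locallyLipschitz x₀
  obtain ⟨r, hr, hrt⟩ := Metric.mem_nhds_iff.1 ht
  let S : Set (EuclideanSpace ℝ (Fin n) × (EuclideanSpace ℝ (Fin n) →L[ℝ] ℝ)) :=
    (Metric.closedBall x₀ (r / 2) ×ˢ Metric.closedBall 0 C) ∩
      {p | ∀ x, f p.1 + p.2 (x - p.1) ≤ f x}
  have hclosed : IsClosed {p : EuclideanSpace ℝ (Fin n) × (EuclideanSpace ℝ (Fin n) →L[ℝ] ℝ) |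
      ∀ x, f p.1 + p.2 (x - p.1) ≤ f x} := by
    simp only [Set.ofPred_forall]
    exact isClosed_iInter fun x => isClosed_le (by fun_prop) continuous_const
  have hS : IsCompact S :=
    ((isCompact_closedBall _ _).prod (isCompact_closedBall _ _)).inter_right hclosed
  have hex (y : EuclideanSpace ℝ (Fin n)) (hy : y ∈ Metric.ball x₀ (r / 2)) :
      ∃ a, (y, a) ∈ S := by
    obtain ⟨a, ha⟩ := hf.exists_subgradient hfc y
    have hyt : t ∈ nhds y := Filter.mem_of_superset
      (Metric.isOpen_ball.mem_nhds (Metric.ball_subset_ball (by linarith) hy)) hrt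
    exact ⟨a, ⟨Metric.ball_subset_closedBall hy,
      mem_closedBall_zero_iff.2 (hL.norm_subgradient_le hyt ha)⟩, ha⟩
  have hx₀ : x₀ ∈ Metric.ball x₀ (r / 2) := Metric.mem_ball_self (half_pos hr)
  obtain ⟨a₀, ha₀⟩ := hex x₀ hx₀
  exact ⟨{
    K := S
    cK := isCompact_iff_compactSpace.1 hS
    nK := ⟨⟨(x₀, a₀), ha₀⟩⟩
    U := Metric.ball x₀ (r / 2)
    openU := Metric.isOpen_ball
    memU := hx₀
    F := fun x p => f p.1.1 + p.1.2 (x - p.1.1)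
    DF := fun _ p => p.1.2
    contF := by fun_prop
    hasDF := fun x _ p =>
      (p.1.2.hasFDerivAt.comp x ((hasFDerivAt_id x).sub_const p.1.1)).const_add (f p.1.1)
    contDF := by fun_prop
    isMax := fun x hx => by
      obtain ⟨a, ha⟩ := hex x hx
      refine ⟨⟨⟨(x, a), ha⟩, by simp⟩, ?_⟩
      rintro _ ⟨p, rfl⟩
      exact p.2.2 x }⟩

end
end

section
/- Let K be a nonempty compact topological space, U ⊆ ℝ^n open, and F : U × K → ℝ a jointly continuous function whose partial differential in the first variable exists at every point of U × K and is jointly continuous on U × K. Then the function f : U → ℝ defined by f(x) = max_{y ∈ K} F(x, y) is locally Lipschitz on U. -/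
noncomputable section

open Topology in
/-- A function that is continuous near a fibre `{x₀} × K` with `K` compact is bounded in norm on a
tube around that fibre. -/
theorem exists_eventually_forall_nnnorm_le_of_continuousAt {X K E : Type*} [TopologicalSpace X]
    [TopologicalSpace K] [CompactSpace K] [SeminormedAddCommGroup E] {g : X → K → E} {x₀ : X}
    (hg : ∀ y, ContinuousAt (fun p : X × K => g p.1 p.2) (x₀, y)) :
    ∃ C : NNReal, ∀ᶠ x in 𝓝 x₀, ∀ y, ‖g x y‖₊ ≤ C := by
  have hcont : Continuous fun y => ‖g x₀ y‖₊ := continuous_iff_continuousAt.2 fun y =>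
    (ContinuousAt.comp (f := fun y => (x₀, y)) (hg y) (by fun_prop)).nnnorm
  obtain ⟨C, hC⟩ := (isCompact_range hcont).bddAbove
  refine ⟨C + 1, ?_⟩
  have htube := isCompact_univ.eventually_forall_of_forall_eventually (x₀ := x₀)
    (P := fun x y => ‖g x y‖₊ ≤ C + 1) fun y _ =>
      ((hg y).nnnorm.eventually_lt_const
        ((hC ⟨y, rfl⟩).trans_lt (lt_add_one C))).mono fun _ h => h.le
  exact htube.mono fun x hx y => hx y (Set.mem_univ y)

/-- A pointwise bounded supremum of functions with a common Lipschitz constant is Lipschitz. -/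
theorem LipschitzOnWith.ciSup_real {X ι : Type*} [PseudoMetricSpace X] [Nonempty ι]
    {F : X → ι → ℝ} {s : Set X} {C : NNReal} (hF : ∀ i, LipschitzOnWith C (fun x => F x i) s)
    (hb : ∀ x ∈ s, BddAbove (Set.range (F x))) :
    LipschitzOnWith C (fun x => ⨆ i, F x i) s :=
  LipschitzOnWith.of_le_add_mul C fun x hx x' hx' => ciSup_le fun i =>
    ((hF i).le_add_mul hx hx').trans (by gcongr; exact le_ciSup (hb x' hx') i)

/-- if `F : U × K → ℝ` is jointly continuous with jointly continuous partial
differential in the first variable, `K` compact nonempty, then `f(x) = max_{y ∈ K} F(x, y)`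
is locally Lipschitz on the open set `U`. -/
theorem max_over_compact_locallyLipschitz (n : ℕ)
    (K : Type) [TopologicalSpace K] [CompactSpace K] [Nonempty K]
    (U : Set (EuclideanSpace ℝ (Fin n))) (hU : IsOpen U)
    (F : EuclideanSpace ℝ (Fin n) → K → ℝ)
    (DF : EuclideanSpace ℝ (Fin n) → K → (EuclideanSpace ℝ (Fin n) →L[ℝ] ℝ))
    (hF : ContinuousOn (fun p : EuclideanSpace ℝ (Fin n) × K => F p.1 p.2) (U ×ˢ Set.univ))
    (hD : ∀ x ∈ U, ∀ y : K, HasFDerivAt (fun x' => F x' y) (DF x y) x)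
    (hDF : ContinuousOn (fun p : EuclideanSpace ℝ (Fin n) × K => DF p.1 p.2) (U ×ˢ Set.univ)) :
    ∀ x ∈ U, ∃ (L : NNReal), ∃ t ∈ nhdsWithin x U,
      LipschitzOnWith L (fun x' => ⨆ y : K, F x' y) t := by
  intro x₀ hx₀
  obtain ⟨C, hC⟩ := exists_eventually_forall_nnnorm_le_of_continuousAt fun y =>
    hDF.continuousAt ((hU.prod isOpen_univ).mem_nhds (Set.mk_mem_prod hx₀ (Set.mem_univ y)))
  obtain ⟨r, hr, hball⟩ :=
    Metric.eventually_nhds_iff_ball.1 ((hU.eventually_mem hx₀).and hC)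
  refine ⟨C, Metric.ball x₀ r, mem_nhdsWithin_of_mem_nhds (Metric.ball_mem_nhds x₀ hr),
    LipschitzOnWith.ciSup_real (fun y => ?_) fun x hx => ?_⟩
  · exact (convex_ball x₀ r).lipschitzOnWith_of_nnnorm_hasFDerivWithin_le
      (fun x hx => (hD x (hball x hx).1 y).hasFDerivWithinAt) fun x hx => (hball x hx).2 y
  · have hcont : Continuous (F x) :=
      hF.comp_continuous (f := fun y => (x, y)) (by fun_prop)
        fun y => Set.mk_mem_prod (hball x hx).1 (Set.mem_univ y)
    exact (isCompact_range hcont).bddAbove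

end
end
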